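/- Let x, y ∈ ℤ_{-τ} be consecutive (-τ)-integers with x < y (no element of ℤ_{-τ} lies strictly between x and y) and y - x = 1. Then [-τ·y, -τ·x] ∩ ℤ_{-τ} = {-τ·y, -τ·y + 1, -τ·x}, where -τ·x = -τ·y + 1 + 1/τ. -/

import Mathlib

/-- The Ito–Sadahiro transformation `T_{-β}` on `[l_β, r_β)`, where
`l_β = -β/(β+1)` and `r_β = 1/(β+1)`. -/
noncomputable def negT (β : ℝ) (x : ℝ) : ℝ :=
  -β * x - (⌊-β * x - (-β / (β + 1))⌋ : ℝ)

/-- `Fin(-β)`: reals `x` such that `(-β)^k * x ∈ (l_β, r_β)` for some `k : ℤ`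
and some iterate of `T_{-β}` sends it to `0`. -/
def negFin (β : ℝ) (x : ℝ) : Prop :=
  ∃ (k : ℤ) (n : ℕ), ((-β) ^ k * x ∈ Set.Ioo (-β / (β + 1)) (1 / (β + 1))) ∧
    (negT β)^[n] ((-β) ^ k * x) = 0

/-- The set `ℤ_{-β}` of `(-β)`-integers. -/
def negInt (β : ℝ) (x : ℝ) : Prop :=
  x = 0 ∨ ∃ (N : ℕ) (y : ℝ), y ∈ Set.Ioo (-β / (β + 1)) (1 / (β + 1)) ∧
    x = (-β) ^ (N + 1) * y ∧ (negT β)^[N + 1] y = 0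

/-- The `(-β)`-digit `d_{i+1}(y)` of `y ∈ [l_β, r_β)` (indices shifted so that
`negDigit β y i` is the digit `d_{i+1}(y)`). -/
noncomputable def negDigit (β : ℝ) (y : ℝ) (i : ℕ) : ℤ :=
  ⌊-β * ((negT β)^[i] y) - (-β / (β + 1))⌋

/-- The golden ratio `τ = (1+√5)/2`. -/
noncomputable def tau : ℝ := (1 + Real.sqrt 5) / 2

/-- The Rényi transformation `T_β` on `[0,1)`. -/
noncomputable def renyiT (β : ℝ) (x : ℝ) : ℝ := β * x - (⌊β * x⌋ : ℝ)

/-- The set `ℤ_β` of (nonnegative) `β`-integers. -/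
def posInt (β : ℝ) (x : ℝ) : Prop :=
  x = 0 ∨ ∃ N : ℕ, (β ^ (-(N + 1 : ℤ)) * x ∈ Set.Ico (0 : ℝ) 1) ∧
    (renyiT β)^[N + 1] (β ^ (-(N + 1 : ℤ)) * x) = 0

theorem tau_sq : tau ^ 2 = tau + 1 := by
  have h : Real.sqrt 5 ^ 2 = 5 := Real.sq_sqrt (by norm_num)
  unfold tau
  nlinarith

theorem tau_gt : (1.618 : ℝ) < tau := by
  have : (2.236 : ℝ) < Real.sqrt 5 := Real.lt_sqrt_of_sq_lt (by norm_num)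
  unfold tau
  linarith

theorem tau_lt : tau < (1.6181 : ℝ) := by
  have : Real.sqrt 5 < (2.2362 : ℝ) := by
    rw [Real.sqrt_lt' (by norm_num)]
    norm_num
  unfold tau
  linarith

theorem neg_tau_div_tau_add_one : -tau / (tau + 1) = 1 - tau := by
  have := tau_gt
  rw [div_eq_iff (by linarith)]
  linarith [tau_sq]

theorem one_div_tau_add_one : 1 / (tau + 1) = 2 - tau := by
  have := tau_gt
  rw [div_eq_iff (by linarith)]
  linarith [tau_sq]

theorem one_div_tau : 1 / tau = tau - 1 := by
  have := tau_gt
  rw [div_eq_iff (by linarith)]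
  linarith [tau_sq]

/-- `u` lies in `ℤ[τ]` and `v` is its Galois conjugate. -/
def IsGoldenConj (u v : ℝ) : Prop :=
  ∃ a b : ℤ, u = a + b * tau ∧ v = a + b * (1 - tau)

namespace IsGoldenConj

theorem add {u v u' v' : ℝ} (h : IsGoldenConj u v) (h' : IsGoldenConj u' v') :
    IsGoldenConj (u + u') (v + v') := by
  obtain ⟨a, b, rfl, rfl⟩ := h
  obtain ⟨a', b', rfl, rfl⟩ := h'
  exact ⟨a + a', b + b', by push_cast; ring, by push_cast; ring⟩

theorem mul {u v u' v' : ℝ} (h : IsGoldenConj u v) (h' : IsGoldenConj u' v') :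
    IsGoldenConj (u * u') (v * v') := by
  obtain ⟨a, b, rfl, rfl⟩ := h
  obtain ⟨a', b', rfl, rfl⟩ := h'
  refine ⟨a * a' + b * b', a * b' + b * a' + b * b', ?_, ?_⟩ <;> push_cast
  · linear_combination (b * b' : ℝ) * tau_sq
  · linear_combination (b * b' : ℝ) * tau_sq

theorem intCast (d : ℤ) : IsGoldenConj d d := ⟨d, 0, by simp, by simp⟩

theorem neg_tau : IsGoldenConj (-tau) (tau - 1) := ⟨0, -1, by simp, by simp⟩

theorem one_sub_tau : IsGoldenConj (1 - tau) tau :=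
  ⟨1, -1, by push_cast; ring, by push_cast; ring⟩

theorem pow {u v : ℝ} (h : IsGoldenConj u v) (n : ℕ) : IsGoldenConj (u ^ n) (v ^ n) := by
  induction n with
  | zero => simpa using intCast 1
  | succ n ih => simpa only [pow_succ] using ih.mul h

theorem neg {u v : ℝ} (h : IsGoldenConj u v) : IsGoldenConj (-u) (-v) := by
  simpa using (intCast (-1)).mul h

theorem unique {u v v' : ℝ} (h : IsGoldenConj u v) (h' : IsGoldenConj u v') : v = v' := by
  obtain ⟨a, b, rfl, rfl⟩ := h
  obtain ⟨a', b', heq, rfl⟩ := h'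
  have hirr : Irrational tau := Real.goldenRatio_irrational
  have hb : b - b' = 0 := by
    by_contra hne
    refine (hirr.intCast_mul hne).ne_int (a' - a) ?_
    push_cast
    linarith
  obtain rfl : b = b' := by omega
  linarith

end IsGoldenConj

theorem exists_digit_negT_tau {t : ℝ} (ht : t ∈ Set.Ico (1 - tau) (2 - tau)) :
    ∃ d : ℤ, (d = 0 ∨ d = 1) ∧ negT tau t = -tau * t - d ∧
      negT tau t ∈ Set.Ico (1 - tau) (2 - tau) := by
  obtain ⟨h₁, h₂⟩ := ht
  have hτ := tau_sq
  have hg := tau_gt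
  have hl := tau_lt
  refine ⟨⌊-tau * t - (1 - tau)⌋, ?_, ?_, ?_⟩
  · have h0 : 0 ≤ ⌊-tau * t - (1 - tau)⌋ := Int.floor_nonneg.mpr (by nlinarith)
    have h2 : ⌊-tau * t - (1 - tau)⌋ < 2 := Int.floor_lt.mpr (by push_cast; nlinarith)
    omega
  · rw [negT, neg_tau_div_tau_add_one]
  · rw [negT, neg_tau_div_tau_add_one]
    have := Int.floor_le (-tau * t - (1 - tau))
    have := Int.lt_floor_add_one (-tau * t - (1 - tau))
    constructor <;> linarith

theorem isGoldenConj_of_iterate_negT_eq_zero (n : ℕ) {t : ℝ}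
    (ht : t ∈ Set.Ico (1 - tau) (2 - tau)) (h : (negT tau)^[n] t = 0) :
    ∃ v, IsGoldenConj ((-tau) ^ n * t) v ∧ 0 ≤ v ∧ v ≤ tau ^ 2 - tau ^ 2 * (tau - 1) ^ n := by
  induction n generalizing t with
  | zero =>
    obtain rfl : t = 0 := h
    exact ⟨0, by simpa using IsGoldenConj.intCast 0, le_rfl, by simp⟩
  | succ n ih =>
    obtain ⟨d, hd, hT, hmem⟩ := exists_digit_negT_tau ht
    obtain ⟨v, hv, h0, hle⟩ := ih hmem h
    have hp : 0 ≤ (tau - 1) ^ n := pow_nonneg (by linarith [tau_gt]) n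
    have hstep : tau ^ 2 * (tau - 1) ^ (n + 1) = tau ^ 2 * (tau - 1) ^ n - (tau - 1) ^ n := by
      rw [pow_succ]
      linear_combination ((tau - 1) ^ n * (tau - 1)) * tau_sq
    refine ⟨v + (tau - 1) ^ n * d, ?_, ?_, ?_⟩
    · convert hv.add ((IsGoldenConj.neg_tau.pow n).mul (.intCast d)) using 1
      rw [hT]
      ring
    · rcases hd with rfl | rfl <;> simp <;> linarith
    · rcases hd with rfl | rfl <;> simp <;> linarith

theorem negT_tau_eq_zero_of_conj_lt {t s : ℝ} (hc : IsGoldenConj t s)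
    (ht : t ∈ Set.Ico (1 - tau) (2 - tau)) (hs0 : 0 ≤ s) (hs : s < tau ^ 3) :
    negT tau t = 0 := by
  obtain ⟨a, b, rfl, rfl⟩ := hc
  obtain ⟨h₁, h₂⟩ := ht
  have hτ := tau_sq
  have hg := tau_gt
  have hl := tau_lt
  have hcube : tau ^ 3 = 2 * tau + 1 := by linear_combination (tau + 1) * tau_sq
  have hb1 : b < 1 := by
    by_contra! hb
    have : (1 : ℝ) ≤ b := by exact_mod_cast hb
    nlinarith
  have hb3 : -3 < b := by
    by_contra! hb
    have : (b : ℝ) ≤ -3 := by exact_mod_cast hb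
    nlinarith
  rw [negT, neg_tau_div_tau_add_one]
  obtain rfl | rfl | rfl : b = 0 ∨ b = -1 ∨ b = -2 := by omega
  · push_cast at *
    have ha : -1 < a := by
      have : (-1 : ℝ) < a := by linarith
      exact_mod_cast this
    have ha' : a < 1 := by
      have : (a : ℝ) < 1 := by linarith
      exact_mod_cast this
    obtain rfl : a = 0 := by omega
    have : ⌊tau - 1⌋ = 0 := Int.floor_eq_iff.mpr ⟨by push_cast; linarith, by push_cast; linarith⟩
    simp [this]
  · push_cast at *
    have ha : 0 < a := by
      have : (0 : ℝ) < a := by linarith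
      exact_mod_cast this
    have ha' : a < 2 := by
      have : (a : ℝ) < 2 := by linarith
      exact_mod_cast this
    obtain rfl : a = 1 := by omega
    have h1 : -tau * (((1 : ℤ) : ℝ) + -1 * tau) = 1 := by
      push_cast
      linear_combination tau_sq
    rw [h1]
    have : ⌊1 - (1 - tau)⌋ = 1 :=
      Int.floor_eq_iff.mpr ⟨by push_cast; linarith, by push_cast; linarith⟩
    rw [this]
    simp
  · push_cast at *
    have ha : 2 < a := by
      have : (2 : ℝ) < a := by linarith
      exact_mod_cast this
    have ha' : a < 3 := by
      have : (a : ℝ) < 3 := by linarith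
      exact_mod_cast this
    omega

theorem iterate_negT_tau_eq_zero (n : ℕ) {t s : ℝ} (hc : IsGoldenConj t s)
    (ht : t ∈ Set.Ico (1 - tau) (2 - tau)) (hs0 : 0 ≤ s) (hs : s < tau ^ (n + 3)) :
    (negT tau)^[n + 1] t = 0 := by
  induction n generalizing t s with
  | zero => exact negT_tau_eq_zero_of_conj_lt hc ht hs0 hs
  | succ n ih =>
    have hτ := tau_sq
    have hg := tau_gt
    have hl := tau_lt
    obtain ⟨d, hd, hT, hmem⟩ := exists_digit_negT_tau ht
    rw [Function.iterate_succ_apply]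
    have hc' : IsGoldenConj (negT tau t) ((tau - 1) * s - d) := by
      rw [hT, sub_eq_add_neg, sub_eq_add_neg _ (d : ℝ)]
      exact (IsGoldenConj.neg_tau.mul hc).add (IsGoldenConj.intCast d).neg
    refine ih hc' hmem ?_ ?_
    · rcases hd with rfl | rfl
      · push_cast
        nlinarith
      · suffices tau ≤ s by
          push_cast
          nlinarith
        by_contra! hlt
        obtain ⟨a, b, rfl, rfl⟩ := hc
        rw [hT] at hmem
        obtain ⟨h₁, h₂⟩ := ht
        obtain ⟨h₃, h₄⟩ := hmem
        push_cast at h₃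
        have hneg : (a + b * tau : ℝ) < -0.2 := by nlinarith
        have hb1 : b < 1 := by
          by_contra! hb
          have : (1 : ℝ) ≤ b := by exact_mod_cast hb
          nlinarith
        have hb2 : -1 < b := by
          by_contra! hb
          have : (b : ℝ) ≤ -1 := by exact_mod_cast hb
          nlinarith
        obtain rfl : b = 0 := by omega
        push_cast at *
        have ha : -1 < a := by
          have : (-1 : ℝ) < a := by linarith
          exact_mod_cast this
        have ha' : a < 0 := by
          have : (a : ℝ) < 0 := by linarith
          exact_mod_cast this
        omega
    · have h1 : (tau - 1) * s < (tau - 1) * tau ^ (n + 1 + 3) := by gcongr; linarith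
      have h2 : (tau - 1) * tau ^ (n + 1 + 3) = tau ^ (n + 3) := by
        linear_combination tau ^ (n + 3) * tau_sq
      rcases hd with rfl | rfl <;> push_cast <;> linarith

/-- The `(-τ)`-integers are the elements of `ℤ[τ]` whose conjugate lies in `[0, τ²)`. -/
theorem negInt_tau_iff (z : ℝ) :
    negInt tau z ↔ ∃ v, IsGoldenConj z v ∧ 0 ≤ v ∧ v < tau ^ 2 := by
  have hτ := tau_sq
  have hg := tau_gt
  have hl := tau_lt
  rw [negInt, neg_tau_div_tau_add_one, one_div_tau_add_one]
  constructor
  · rintro (rfl | ⟨N, y, hy, rfl, hT⟩)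
    · exact ⟨0, by simpa using IsGoldenConj.intCast 0, le_rfl, by positivity⟩
    · obtain ⟨v, hv, h0, hle⟩ :=
        isGoldenConj_of_iterate_negT_eq_zero (N + 1) (Set.Ioo_subset_Ico_self hy) hT
      have : 0 < (tau - 1) ^ (N + 1) := pow_pos (by linarith) _
      exact ⟨v, hv, h0, hle.trans_lt (sub_lt_self _ (by positivity))⟩
  · rintro ⟨v, hv, h0, hlt⟩
    right
    have hlim : Filter.Tendsto (fun N : ℕ => (1 - tau) ^ (N + 1) * z) Filter.atTop (nhds 0) := by
      have := (tendsto_pow_atTop_nhds_zero_of_abs_lt_one (r := 1 - tau)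
        (abs_lt.mpr ⟨by linarith, by linarith⟩)).comp (Filter.tendsto_add_atTop_nat 1)
      simpa using this.mul_const z
    obtain ⟨N, hN⟩ := (hlim.eventually
      (Ioo_mem_nhds (show 1 - tau < 0 by linarith) (show 0 < 2 - tau by linarith))).exists
    refine ⟨N, _, hN, ?_, ?_⟩
    · rw [← mul_assoc, ← mul_pow, show -tau * (1 - tau) = 1 by linear_combination hτ]
      simp
    · refine iterate_negT_tau_eq_zero N ((IsGoldenConj.one_sub_tau.pow (N + 1)).mul hv)
        (Set.Ioo_subset_Ico_self hN) (by positivity) ?_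
      rw [show N + 3 = (N + 1) + 2 by ring, pow_add _ (N + 1) 2]
      gcongr

/-- If `x < y` are consecutive `(-τ)`-integers at distance `1`, then
`[-τy, -τx] ∩ ℤ_{-τ} = {-τy, -τy + 1, -τx}` with `-τx = -τy + 1 + 1/τ`. -/
theorem minus_tau_image_of_gap_one
    (x y : ℝ) (hx : negInt tau x) (hy : negInt tau y) (hxy : x < y)
    (hcons : ∀ w : ℝ, negInt tau w → w ∉ Set.Ioo x y) (hgap : y - x = 1) :
    Set.Icc (-tau * y) (-tau * x) ∩ {w : ℝ | negInt tau w}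
        = {-tau * y, -tau * y + 1, -tau * x} ∧
      -tau * x = -tau * y + 1 + 1 / tau := by
  have hτ := tau_sq
  have hg := tau_gt
  have hl := tau_lt
  obtain rfl : x = y - 1 := by linarith
  obtain ⟨u, hu, hu0, hu2⟩ := (negInt_tau_iff _).mp hx
  have hy' : IsGoldenConj y (u + 1) := by
    simpa using hu.add (IsGoldenConj.intCast 1)
  obtain ⟨v, hv, hv0, hv2⟩ := (negInt_tau_iff _).mp hy
  have hvu : v = u + 1 := hv.unique hy'
  subst hvu
  have hleft : IsGoldenConj (-tau * y) ((tau - 1) * (u + 1)) := IsGoldenConj.neg_tau.mul hy'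
  refine ⟨?_, by rw [one_div_tau]; ring⟩
  ext w
  simp only [Set.mem_inter_iff, Set.mem_Icc, Set.mem_ofPred_eq, Set.mem_insert_iff,
    Set.mem_singleton_iff]
  constructor
  · rintro ⟨⟨h₁, h₂⟩, hw⟩
    obtain ⟨q, hq, hq0, hq2⟩ := (negInt_tau_iff _).mp hw
    obtain ⟨a, b, hab, hab'⟩ := hq.add hleft.neg
    have hqlo : -tau < q + -((tau - 1) * (u + 1)) := by nlinarith
    have hqhi : q + -((tau - 1) * (u + 1)) < 2 := by nlinarith
    have hb1 : b < 2 := by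
      by_contra! hb
      have : (2 : ℝ) ≤ b := by exact_mod_cast hb
      nlinarith
    have hb2 : -1 < b := by
      by_contra! hb
      have : (b : ℝ) ≤ -1 := by exact_mod_cast hb
      nlinarith
    obtain rfl | rfl : b = 0 ∨ b = 1 := by omega
    · push_cast at *
      have ha : -1 < a := by
        have : (-1 : ℝ) < a := by linarith
        exact_mod_cast this
      have ha' : a < 2 := by
        have : (a : ℝ) < 2 := by linarith
        exact_mod_cast this
      obtain rfl | rfl : a = 0 ∨ a = 1 := by omega
      · left; push_cast at *; linarith
      · right; left; push_cast at *; linarith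
    · push_cast at *
      have ha : -1 < a := by
        have : (-1 : ℝ) < a := by linarith
        exact_mod_cast this
      have ha' : a < 1 := by
        have : (a : ℝ) < 1 := by linarith
        exact_mod_cast this
      obtain rfl : a = 0 := by omega
      right; right; push_cast at *; linarith
  · rintro (rfl | rfl | rfl)
    · exact ⟨⟨le_rfl, by linarith⟩, (negInt_tau_iff _).mpr ⟨_, hleft, by nlinarith, by nlinarith⟩⟩
    · refine ⟨⟨by linarith, by linarith⟩, (negInt_tau_iff _).mpr
        ⟨(tau - 1) * (u + 1) + 1, ?_, by nlinarith, by nlinarith⟩⟩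
      simpa using hleft.add (IsGoldenConj.intCast 1)
    · exact ⟨⟨by linarith, le_rfl⟩, (negInt_tau_iff _).mpr
        ⟨_, IsGoldenConj.neg_tau.mul hu, by nlinarith, by nlinarith⟩⟩
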